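/- Assume X has full row rank and let V₂(β) = ‖(X Σ⁻¹ Xᵀ)^{−1/2} X (β − B̂)‖². Then for every β ∈ ℝ^p, ∫_{ℝ^p} V₂(β') k_AC(β,β') dβ' ≤ λ_max²(X Σ⁻¹ Xᵀ) · V₂(β) + 2n, where λ_max(·) denotes the largest eigenvalue. -/

import Mathlib

open MeasureTheory Matrix Filter

noncomputable section

/-- standard normal pdf -/
def nphi (x : ℝ) : ℝ := (Real.sqrt (2 * Real.pi))⁻¹ * Real.exp (-(x ^ 2) / 2)

/-- standard normal cdf -/
def nPhi (x : ℝ) : ℝ := ∫ t in Set.Iic x, nphi t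

/-- density of TN(θ,1;1) (if b = true) resp. TN(θ,1;0) (if b = false) at z -/
def tn (θ : ℝ) (b : Bool) (z : ℝ) : ℝ :=
  if b then (if 0 < z then nphi (z - θ) / nPhi θ else 0)
  else (if z < 0 then nphi (z - θ) / (1 - nPhi θ) else 0)

/-- p-variate Gaussian density with mean μ and covariance matrix Λ -/
def mvn {p : ℕ} (μ : Fin p → ℝ) (Λ : Matrix (Fin p) (Fin p) ℝ) (x : Fin p → ℝ) : ℝ :=
  Real.sqrt (((2 * Real.pi) ^ p * Λ.det)⁻¹) *
    Real.exp (-(dotProduct (x - μ) (Λ⁻¹.mulVec (x - μ))) / 2)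

/-- squared Euclidean norm -/
def normSq {m : ℕ} (x : Fin m → ℝ) : ℝ := ∑ i, x i ^ 2

/-- Albert and Chib's Markov transition density, with Σ = XᵀX + Q -/
def kAC {n p : ℕ} (X : Matrix (Fin n) (Fin p) ℝ) (Y : Fin n → Bool)
    (v : Fin p → ℝ) (Q : Matrix (Fin p) (Fin p) ℝ) (β β' : Fin p → ℝ) : ℝ :=
  ∫ z : Fin n → ℝ,
    mvn ((Xᵀ * X + Q)⁻¹.mulVec (Xᵀ.mulVec z + Q.mulVec v)) (Xᵀ * X + Q)⁻¹ β' *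
      ∏ i, tn (dotProduct (X i) β) (Y i) (z i)

/-- the defining property of the posterior mode B̂ -/
def IsPosteriorMode {n p : ℕ} (X : Matrix (Fin n) (Fin p) ℝ) (Y : Fin n → Bool)
    (v : Fin p → ℝ) (Q : Matrix (Fin p) (Fin p) ℝ) (Bhat : Fin p → ℝ) : Prop :=
  (∑ i, (if Y i then nphi (dotProduct (X i) Bhat) / nPhi (dotProduct (X i) Bhat)
          else -(nphi (dotProduct (X i) Bhat) / (1 - nPhi (dotProduct (X i) Bhat)))) • X i)
    - Q.mulVec (Bhat - v) = 0

/-- largest eigenvalue of a symmetric real matrix, as the supremum of the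
Rayleigh quotient -/
def lmax {m : ℕ} (M : Matrix (Fin m) (Fin m) ℝ) : ℝ :=
  sSup {r : ℝ | ∃ x : Fin m → ℝ, x ≠ 0 ∧ r = dotProduct x (M.mulVec x) / normSq x}

/-- moments of a density -/
def HasMom (ρ : ℝ → ℝ) (m s : ℝ) : Prop :=
  Integrable ρ ∧ Integrable (fun z => z * ρ z) ∧ Integrable (fun z => z ^ 2 * ρ z) ∧
  ∫ z, ρ z = 1 ∧ ∫ z, z * ρ z = m ∧ ∫ z, z ^ 2 * ρ z = s + m ^ 2

lemma HasMom.center {ρ : ℝ → ℝ} {m s : ℝ} (h : HasMom ρ m s) (c d : ℝ) :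
    Integrable (fun z => (z - c) * ρ z) ∧ Integrable (fun z => (z - c) * (z - d) * ρ z) ∧
    ∫ z, (z - c) * ρ z = m - c ∧
    ∫ z, (z - c) * (z - d) * ρ z = s + (m - c) * (m - d) := by
  obtain ⟨h0, h1, h2, e0, e1, e2⟩ := h
  have E1 : (fun z => (z - c) * ρ z) = fun z => z * ρ z - c * ρ z := by ext z; ring
  have E2 : (fun z => (z - c) * (z - d) * ρ z) =
      fun z => z ^ 2 * ρ z - (c + d) * (z * ρ z) + c * d * ρ z := by ext z; ring
  rw [E1, E2]
  refine ⟨h1.sub (h0.const_mul c), (h2.sub (h1.const_mul _)).add (h0.const_mul _), ?_, ?_⟩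
  · rw [integral_sub h1 (h0.const_mul c), integral_const_mul, e0, e1]; ring
  · have h3 : Integrable (fun z => z ^ 2 * ρ z - (c + d) * (z * ρ z)) := h2.sub (h1.const_mul _)
    rw [integral_add h3 (h0.const_mul _),
      integral_sub h2 (h1.const_mul _), integral_const_mul, integral_const_mul, e0, e1, e2]; ring

lemma HasMom.shift {ρ : ℝ → ℝ} {m s : ℝ} (h : HasMom ρ m s) (θ : ℝ) :
    HasMom (fun z => ρ (z - θ)) (θ + m) s := by
  have h' := h.center (-θ) (-θ)
  obtain ⟨h0, h1, h2, e0, e1, e2⟩ := h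
  obtain ⟨c1, c2, d1, d2⟩ := h'
  have E1 : (fun z => z * ρ (z - θ)) = fun z => (fun w => (w - -θ) * ρ w) (z - θ) := by
    ext z; simp
  have E2 : (fun z => z ^ 2 * ρ (z - θ)) = fun z => (fun w => (w - -θ) * (w - -θ) * ρ w) (z - θ) := by
    ext z; simp only []; ring_nf
  refine ⟨h0.comp_sub_right θ, ?_, ?_, ?_, ?_, ?_⟩
  · rw [E1]; exact c1.comp_sub_right θ
  · rw [E2]; exact c2.comp_sub_right θ
  · rw [integral_sub_right_eq_self ρ θ, e0]
  · rw [E1, integral_sub_right_eq_self (fun w => (w - -θ) * ρ w) θ, d1]; ring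
  · rw [E2, integral_sub_right_eq_self (fun w => (w - -θ) * (w - -θ) * ρ w) θ, d2]; ring

lemma HasMom.refl {ρ : ℝ → ℝ} {m s : ℝ} (h : HasMom ρ m s) :
    HasMom (fun z => ρ (-z)) (-m) s := by
  obtain ⟨h0, h1, h2, e0, e1, e2⟩ := h
  have E1 : (fun z => z * ρ (-z)) = fun z => (fun w => -(w * ρ w)) (-z) := by
    ext z; simp
  have E2 : (fun z => z ^ 2 * ρ (-z)) = fun z => (fun w => w ^ 2 * ρ w) (-z) := by
    ext z; simp
  refine ⟨h0.comp_neg, ?_, ?_, ?_, ?_, ?_⟩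
  · rw [E1]; exact h1.neg.comp_neg
  · rw [E2]; exact h2.comp_neg
  · rw [integral_neg_eq_self ρ, e0]
  · rw [E1, integral_neg_eq_self (fun w => -(w * ρ w)), integral_neg, e1]
  · rw [E2, integral_neg_eq_self (fun w => w ^ 2 * ρ w), e2]; ring

lemma nphi_pos (x : ℝ) : 0 < nphi x := by unfold nphi; positivity

lemma nphi_neg (x : ℝ) : nphi (-x) = nphi x := by simp [nphi]

lemma nphi_cont : Continuous nphi := by unfold nphi; fun_prop

lemma nphi_eq : nphi = ProbabilityTheory.gaussianPDFReal 0 1 := by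
  ext x; simp [nphi, ProbabilityTheory.gaussianPDFReal]

lemma nphi_int : Integrable nphi := by
  rw [nphi_eq]; exact ProbabilityTheory.integrable_gaussianPDFReal _ _

lemma nphi_int1 : Integrable (fun z => z * nphi z) := by
  have := (integrable_mul_exp_neg_mul_sq (b := 1/2) (by norm_num)).const_mul (Real.sqrt (2 * Real.pi))⁻¹
  convert! this using 2 with z
  simp only [nphi]; ring_nf

lemma nphi_int2 : Integrable (fun z => z ^ 2 * nphi z) := by
  have := (integrable_rpow_mul_exp_neg_mul_sq (b := 1/2) (by norm_num) (s := 2) (by norm_num)).const_mul (Real.sqrt (2 * Real.pi))⁻¹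
  convert! this using 2 with z
  simp only [nphi, Real.rpow_two]; ring_nf

lemma nphi_deriv (x : ℝ) : HasDerivAt nphi (-x * nphi x) x := by
  unfold nphi
  have : HasDerivAt (fun x : ℝ => -(x ^ 2) / 2) (-x) x := by
    have := ((hasDerivAt_pow 2 x).neg).div_const 2
    convert! this using 1; simp; ring
  convert! (this.exp).const_mul (Real.sqrt (2 * Real.pi))⁻¹ using 1
  ring

lemma xnphi_deriv (x : ℝ) : HasDerivAt (fun x => -(x * nphi x)) (x ^ 2 * nphi x - nphi x) x := by
  convert! ((hasDerivAt_id x).mul (nphi_deriv x)).neg using 1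
  simp; ring

lemma nphi_deriv' (x : ℝ) : HasDerivAt (fun x => -nphi x) (x * nphi x) x := by
  convert! (nphi_deriv x).neg using 1
  ring

lemma nphi_top : Tendsto nphi atTop (nhds 0) :=
  tendsto_zero_of_hasDerivAt_of_integrableOn_Ioi (a := 0)
    (fun x _ => nphi_deriv x) (by simpa using! nphi_int1.neg.integrableOn) nphi_int.integrableOn

lemma xnphi_top : Tendsto (fun x => -(x * nphi x)) atTop (nhds 0) :=
  tendsto_zero_of_hasDerivAt_of_integrableOn_Ioi (a := 0)
    (fun x _ => xnphi_deriv x) (nphi_int2.sub nphi_int).integrableOn nphi_int1.neg.integrableOn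

lemma xnphi_bot : Tendsto (fun x => -(x * nphi x)) atBot (nhds 0) :=
  tendsto_zero_of_hasDerivAt_of_integrableOn_Iic (a := 0)
    (fun x _ => xnphi_deriv x) (nphi_int2.sub nphi_int).integrableOn nphi_int1.neg.integrableOn

lemma nphi_one : ∫ x, nphi x = 1 := by
  rw [nphi_eq]; exact ProbabilityTheory.integral_gaussianPDFReal_eq_one _ (by norm_num)

lemma nphi_mom : HasMom nphi 0 1 := by
  refine ⟨nphi_int, nphi_int1, nphi_int2, nphi_one, ?_, ?_⟩
  · have h := integral_neg_eq_self (fun z => z * nphi z) (volume : Measure ℝ)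
    simp only [nphi_neg, neg_mul, integral_neg] at h
    linarith
  · have h := integral_of_hasDerivAt_of_tendsto xnphi_deriv (nphi_int2.sub nphi_int) xnphi_bot xnphi_top
    rw [integral_sub nphi_int2 nphi_int, nphi_one] at h
    linarith

lemma nPhi_eq (θ : ℝ) : ∫ x in Set.Ioi (-θ), nphi x = nPhi θ := by
  unfold nPhi
  rw [← integral_comp_neg_Iic]
  simp [nphi_neg]

lemma nPhi_pos (θ : ℝ) : 0 < nPhi θ := by
  unfold nPhi
  rw [setIntegral_pos_iff_support_of_nonneg_ae (ae_of_all _ fun x => (nphi_pos x).le) nphi_int.integrableOn]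
  have : Function.support nphi = Set.univ := by ext x; simp [(nphi_pos x).ne']
  simp [this]

lemma nPhi_compl (θ : ℝ) : 1 - nPhi θ = nPhi (-θ) := by
  rw [← nPhi_eq (-θ), neg_neg, ← nphi_one, nPhi]
  have := integral_add_compl (measurableSet_Iic (a := θ)) nphi_int
  rw [Set.compl_Iic] at this
  linarith

lemma nPhi_deriv (θ : ℝ) : HasDerivAt nPhi (nphi θ) θ := by
  have h : nPhi = fun x => nPhi 0 + ∫ t in (0:ℝ)..x, nphi t := by
    ext x
    have := intervalIntegral.integral_Iic_sub_Iic (a := 0) (b := x) (f := nphi) (μ := volume)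
      nphi_int.integrableOn nphi_int.integrableOn
    simp only [nPhi]; linarith
  rw [h]
  exact (intervalIntegral.integral_hasDerivAt_right nphi_int.intervalIntegrable
    nphi_cont.aestronglyMeasurable.stronglyMeasurableAtFilter nphi_cont.continuousAt).const_add _

/-- inverse Mills ratio -/
def gm (θ : ℝ) : ℝ := nphi θ / nPhi θ

lemma gm_pos (θ : ℝ) : 0 < gm θ := div_pos (nphi_pos _) (nPhi_pos _)

lemma trunc_mom (θ : ℝ) :
    HasMom (Set.indicator (Set.Ioi (-θ)) (fun w => nphi w / nPhi θ)) (gm θ)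
      (1 - gm θ * (θ + gm θ)) := by
  have hP := (nPhi_pos θ).ne'
  have hm := measurableSet_Ioi (a := -θ)
  have E (k : ℝ → ℝ) : (fun z => k z * Set.indicator (Set.Ioi (-θ)) (fun w => nphi w / nPhi θ) z) =
      Set.indicator (Set.Ioi (-θ)) (fun z => k z * nphi z / nPhi θ) := by
    ext z; by_cases h : z ∈ Set.Ioi (-θ) <;> simp [h, mul_div_assoc]
  have i1 : ∫ x in Set.Ioi (-θ), x * nphi x = nphi θ := by
    have := integral_Ioi_of_hasDerivAt_of_tendsto' (a := -θ) (fun x _ => nphi_deriv' x) nphi_int1.integrableOn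
      nphi_top.neg
    rw [this]; simp [nphi_neg]
  have i2 : ∫ x in Set.Ioi (-θ), x ^ 2 * nphi x = nPhi θ - θ * nphi θ := by
    have := integral_Ioi_of_hasDerivAt_of_tendsto' (a := -θ) (fun x _ => xnphi_deriv x)
      (nphi_int2.sub nphi_int).integrableOn xnphi_top
    rw [integral_sub nphi_int2.integrableOn nphi_int.integrableOn, nPhi_eq, nphi_neg] at this
    linarith
  refine ⟨(nphi_int.div_const _).indicator hm, ?_, ?_, ?_, ?_, ?_⟩
  · rw [E]; exact (nphi_int1.div_const _).indicator hm
  · rw [E]; exact (nphi_int2.div_const _).indicator hm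
  · rw [integral_indicator hm, integral_div, nPhi_eq, div_self hP]
  · rw [E, integral_indicator hm, integral_div, i1, gm]
  · rw [E, integral_indicator hm, integral_div, i2, gm]; field_simp; ring

lemma tn_true (θ : ℝ) : tn θ true =
    fun z => Set.indicator (Set.Ioi (-θ)) (fun w => nphi w / nPhi θ) (z - θ) := by
  ext z; simp [tn, Set.indicator_apply]

lemma tn_false (θ : ℝ) : tn θ false = fun z => tn (-θ) true (-z) := by
  ext z
  simp only [tn, nPhi_compl]
  have : -z - -θ = -(z - θ) := by ring
  rw [this, nphi_neg]; simp

/-- mean of TN -/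
def tmean (θ : ℝ) (b : Bool) : ℝ := θ + (if b then gm θ else - gm (-θ))

/-- variance of TN -/
def tvar (θ : ℝ) (b : Bool) : ℝ :=
  if b then 1 - gm θ * (θ + gm θ) else 1 - gm (-θ) * (-θ + gm (-θ))

lemma tn_mom (θ : ℝ) (b : Bool) : HasMom (tn θ b) (tmean θ b) (tvar θ b) := by
  cases b
  · rw [tn_false, tn_true]
    convert! ((trunc_mom (-θ)).shift (-θ)).refl using 1
    · simp [tmean]; ring
  · rw [tn_true]
    convert! (trunc_mom θ).shift θ using 1

lemma tn_nonneg (θ : ℝ) (b : Bool) (z : ℝ) : 0 ≤ tn θ b z := by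
  have h (θ z : ℝ) : 0 ≤ tn θ true z := by
    rw [tn_true]; exact Set.indicator_nonneg (fun w _ => (div_pos (nphi_pos _) (nPhi_pos _)).le) _
  cases b
  · rw [tn_false]; exact h _ _
  · exact h _ _

lemma tn_meas (θ : ℝ) (b : Bool) : Measurable (tn θ b) := by
  have h (θ : ℝ) : Measurable (tn θ true) := by
    rw [tn_true]
    exact ((nphi_cont.measurable.div_const _).indicator measurableSet_Ioi).comp (measurable_id.sub_const _)
  cases b
  · rw [tn_false]; exact (h _).comp measurable_neg
  · exact h _

lemma gmean_nonneg (θ : ℝ) : 0 ≤ θ + gm θ := by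
  have h := (tn_mom θ true).2.2.2.2.1
  simp only [tmean, if_true] at h
  rw [← h]
  refine integral_nonneg fun z => ?_
  by_cases hz : 0 < z
  · exact mul_nonneg hz.le (tn_nonneg _ _ _)
  · simp [tn, hz]

lemma gvar_nonneg (θ : ℝ) : 0 ≤ 1 - gm θ * (θ + gm θ) := by
  have h := ((tn_mom θ true).center (θ + gm θ) (θ + gm θ)).2.2.2
  simp only [tmean, tvar, if_true, sub_self, mul_zero, add_zero] at h
  rw [← h]
  exact integral_nonneg fun z => mul_nonneg (mul_self_nonneg _) (tn_nonneg _ _ _)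

lemma tvar_le (θ : ℝ) (b : Bool) : tvar θ b ≤ 1 := by
  cases b
  · have := mul_nonneg (gm_pos (-θ)).le (gmean_nonneg (-θ)); simp only [tvar]; simp; linarith
  · have := mul_nonneg (gm_pos θ).le (gmean_nonneg θ); simp only [tvar]; simp; linarith

lemma gmean_deriv (θ : ℝ) : HasDerivAt (fun θ => θ + gm θ) (1 - gm θ * (θ + gm θ)) θ := by
  have := (hasDerivAt_id θ).add ((nphi_deriv θ).div (nPhi_deriv θ) (nPhi_pos θ).ne')
  convert! this using 1
  have := (nPhi_pos θ).ne'
  simp only [gm]; field_simp; ring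

lemma gmean_lip (a b : ℝ) : |(a + gm a) - (b + gm b)| ≤ |a - b| := by
  have h : LipschitzWith 1 (fun θ => θ + gm θ) := by
    refine lipschitzWith_of_nnnorm_deriv_le (fun θ => (gmean_deriv θ).differentiableAt) fun θ => ?_
    rw [(gmean_deriv θ).deriv, ← NNReal.coe_le_coe]
    simp only [coe_nnnorm, Real.norm_eq_abs, NNReal.coe_one]
    have := mul_nonneg (gm_pos θ).le (gmean_nonneg θ)
    rw [abs_of_nonneg (gvar_nonneg θ)]; linarith
  simpa [Real.dist_eq] using h.dist_le_mul a b

lemma tmean_lip (a b : ℝ) (y : Bool) : |tmean a y - tmean b y| ≤ |a - b| := by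
  cases y
  · have h := gmean_lip (-b) (-a)
    simp only [tmean]
    convert h using 2 <;> simp <;> ring
  · simpa [tmean] using gmean_lip a b

lemma prod_aux {n : ℕ} (ρ : Fin n → ℝ → ℝ) (i j : Fin n) (c z : Fin n → ℝ) :
    (z i - c i) * (z j - c j) * ∏ k, ρ k (z k) =
    ∏ k, ((if k = i then z k - c k else 1) * (if k = j then z k - c k else 1) * ρ k (z k)) := by
  rw [Finset.prod_mul_distrib, Finset.prod_mul_distrib]
  simp

lemma prod_mom {n : ℕ} (ρ : Fin n → ℝ → ℝ) (m s : Fin n → ℝ) (h : ∀ i, HasMom (ρ i) (m i) (s i))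
    (c : Fin n → ℝ) (i j : Fin n) :
    Integrable (fun z : Fin n → ℝ => (z i - c i) * (z j - c j) * ∏ k, ρ k (z k)) ∧
    ∫ z : Fin n → ℝ, (z i - c i) * (z j - c j) * ∏ k, ρ k (z k) =
      (m i - c i) * (m j - c j) + if i = j then s i else 0 := by
  simp_rw [prod_aux]
  let f : Fin n → ℝ → ℝ := fun k w =>
    ((if k = i then w - c k else 1) * (if k = j then w - c k else 1) * ρ k w)
  have hc := fun k => (h k).center (c k) (c k)
  constructor
  · refine Integrable.fintype_prod (f := f) fun k => ?_
    by_cases hi : k = i <;> by_cases hj : k = j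
    · simpa only [f, if_pos hi, if_pos hj] using (hc k).2.1
    · simpa only [f, if_pos hi, if_neg hj, mul_one] using (hc k).1
    · simpa only [f, if_neg hi, if_pos hj, one_mul] using (hc k).1
    · simpa only [f, if_neg hi, if_neg hj, one_mul] using (h k).1
  · rw [integral_fintype_prod_volume_eq_prod f]
    have hf : ∀ k, ∫ w, f k w = (if k = i then (m k - c k) else 1) * (if k = j then (m k - c k) else 1)
        + (if k = i then if k = j then s k else 0 else 0) := by
      intro k
      by_cases hi : k = i <;> by_cases hj : k = j
      · simp only [f, if_pos hi, if_pos hj, (hc k).2.2.2]; ring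
      · simp only [f, if_pos hi, if_neg hj, mul_one, (hc k).2.2.1]; ring
      · simp only [f, if_neg hi, if_pos hj, one_mul, (hc k).2.2.1]; ring
      · simp only [f, if_neg hi, if_neg hj, one_mul, (h k).2.2.2.1]; ring
    simp_rw [hf]
    by_cases hij : i = j
    · subst hij
      rw [Finset.prod_eq_single i]
      · simp
      · intro b _ hb; simp [hb]
      · simp
    · have : ∀ k, (if k = i then (m k - c k) else 1) * (if k = j then (m k - c k) else 1)
        + (if k = i then if k = j then s k else 0 else 0) =
        (if k = i then (m k - c k) else 1) * (if k = j then (m k - c k) else 1) := by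
        intro k
        by_cases hi : k = i
        · have : k ≠ j := by rintro rfl; exact hij hi.symm
          simp [this]
        · simp [hi]
      simp_rw [this]
      rw [Finset.prod_mul_distrib]
      simp [hij]

lemma prod_one {n : ℕ} (ρ : Fin n → ℝ → ℝ) (m s : Fin n → ℝ) (h : ∀ i, HasMom (ρ i) (m i) (s i)) :
    Integrable (fun z : Fin n → ℝ => ∏ k, ρ k (z k)) ∧
    ∫ z : Fin n → ℝ, ∏ k, ρ k (z k) = 1 := by
  constructor
  · exact Integrable.fintype_prod (f := ρ) fun k => (h k).1
  · rw [integral_fintype_prod_volume_eq_prod ρ]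
    exact Finset.prod_eq_one fun k _ => (h k).2.2.2.1

lemma quad_expand {n : ℕ} (M : Matrix (Fin n) (Fin n) ℝ) (x : Fin n → ℝ) :
    x ⬝ᵥ M.mulVec x = ∑ i, ∑ j, M i j * (x i * x j) := by
  simp only [dotProduct, mulVec, Finset.mul_sum]
  refine Finset.sum_congr rfl fun i _ => Finset.sum_congr rfl fun j _ => by ring

lemma quad_mom {n : ℕ} (ρ : Fin n → ℝ → ℝ) (m s : Fin n → ℝ) (h : ∀ i, HasMom (ρ i) (m i) (s i))
    (c : Fin n → ℝ) (M : Matrix (Fin n) (Fin n) ℝ) :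
    Integrable (fun z : Fin n → ℝ => ((z - c) ⬝ᵥ M.mulVec (z - c)) * ∏ k, ρ k (z k)) ∧
    ∫ z : Fin n → ℝ, ((z - c) ⬝ᵥ M.mulVec (z - c)) * ∏ k, ρ k (z k) =
      ((m - c) ⬝ᵥ M.mulVec (m - c)) + ∑ i, M i i * s i := by
  have E : (fun z : Fin n → ℝ => ((z - c) ⬝ᵥ M.mulVec (z - c)) * ∏ k, ρ k (z k)) =
    fun z => ∑ i, ∑ j, M i j * ((z i - c i) * (z j - c j) * ∏ k, ρ k (z k)) := by
    ext z
    rw [quad_expand, Finset.sum_mul]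
    refine Finset.sum_congr rfl fun i _ => ?_
    rw [Finset.sum_mul]
    refine Finset.sum_congr rfl fun j _ => by simp only [Pi.sub_apply]; ring
  have I : ∀ i j, Integrable (fun z : Fin n → ℝ => M i j * ((z i - c i) * (z j - c j) * ∏ k, ρ k (z k))) :=
    fun i j => (prod_mom ρ m s h c i j).1.const_mul _
  rw [E]
  constructor
  · exact integrable_finsetSum _ fun i _ => integrable_finsetSum _ fun j _ => I i j
  · rw [integral_finsetSum _ fun i _ => integrable_finsetSum _ fun j _ => I i j]
    simp_rw [integral_finsetSum Finset.univ fun j _ => I _ j, integral_const_mul,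
      fun i j => (prod_mom ρ m s h c i j).2]
    rw [quad_expand, ← Finset.sum_add_distrib]
    refine Finset.sum_congr rfl fun i _ => ?_
    simp only [mul_add, Finset.sum_add_distrib]
    simp

/-- change of variables -/
lemma affine_cov {p : ℕ} (D : Matrix (Fin p) (Fin p) ℝ) (hD : IsUnit D.det) (μ : Fin p → ℝ)
    (f : (Fin p → ℝ) → ℝ) :
    (Integrable f ↔ Integrable fun w => |D.det| * f (μ + D.mulVec w)) ∧
    ∫ x, f x = ∫ w, |D.det| * f (μ + D.mulVec w) := by
  let L : (Fin p → ℝ) →L[ℝ] (Fin p → ℝ) := LinearMap.toContinuousLinearMap (Matrix.toLin' D)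
  have hL : ∀ w, L w = D.mulVec w := fun w => by simp [L]
  have hdet : L.det = D.det := by
    simp [L, ContinuousLinearMap.det]
  have hd : ∀ x ∈ Set.univ, HasFDerivWithinAt (fun w => μ + D.mulVec w) L Set.univ x := by
    intro x _
    have := (L.hasFDerivWithinAt (s := Set.univ) (x := x)).const_add μ
    exact this
  have hinj : Set.InjOn (fun w => μ + D.mulVec w) Set.univ := by
    intro a _ b _ hab
    exact Matrix.mulVec_injective_of_isUnit ((Matrix.isUnit_iff_isUnit_det D).2 hD) (add_left_cancel hab)
  have him : (fun w => μ + D.mulVec w) '' Set.univ = Set.univ := by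
    rw [Set.image_univ, Set.range_eq_univ]
    intro y
    refine ⟨D⁻¹.mulVec (y - μ), ?_⟩
    simp [Matrix.mulVec_mulVec, Matrix.mul_nonsing_inv D hD]
  constructor
  · have := integrableOn_image_iff_integrableOn_abs_det_fderiv_smul volume MeasurableSet.univ hd hinj f
    rw [him] at this
    simpa [hdet] using this
  · have := integral_image_eq_integral_abs_det_fderiv_smul volume MeasurableSet.univ hd hinj f
    rw [him] at this
    simpa [hdet] using this

open scoped MatrixOrder in
lemma gauss_mom {p : ℕ} (S : Matrix (Fin p) (Fin p) ℝ) (hS : S.PosDef) (μ b : Fin p → ℝ)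
    (N : Matrix (Fin p) (Fin p) ℝ) :
    Integrable (fun x => ((x - b) ⬝ᵥ N.mulVec (x - b)) * mvn μ S⁻¹ x) ∧
    ∫ x, ((x - b) ⬝ᵥ N.mulVec (x - b)) * mvn μ S⁻¹ x =
      ((μ - b) ⬝ᵥ N.mulVec (μ - b)) + (N * S⁻¹).trace := by
  obtain ⟨C, hC⟩ : ∃ C : Matrix (Fin p) (Fin p) ℝ, S = Cᵀ * C := by
    have := (CStarAlgebra.nonneg_iff_eq_star_mul_self (a := S)).1 hS.posSemidef.nonneg
    simpa [Matrix.star_eq_conjTranspose] using this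
  have hSd : 0 < S.det := hS.det_pos
  have hSC : S.det = C.det ^ 2 := by rw [hC]; simp; ring
  have hCd : C.det ≠ 0 := by intro h; rw [hSC, h] at hSd; simp at hSd
  have hCu : IsUnit C.det := hCd.isUnit
  have hDu : IsUnit C⁻¹.det := by simpa using hCd
  have hSi : S⁻¹ = C⁻¹ * C⁻¹ᵀ := by
    rw [hC, Matrix.mul_inv_rev, Matrix.transpose_nonsing_inv]
  have key : ∀ w : Fin p → ℝ, |C⁻¹.det| * mvn μ S⁻¹ (μ + C⁻¹.mulVec w) = ∏ k, nphi (w k) := by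
    intro w
    have e1 : (μ + C⁻¹.mulVec w - μ) = C⁻¹.mulVec w := by simp
    have e2 : S⁻¹⁻¹ = S := Matrix.nonsing_inv_nonsing_inv _ hSd.ne'.isUnit
    have e3 : C⁻¹.mulVec w ⬝ᵥ S.mulVec (C⁻¹.mulVec w) = ∑ k, w k ^ 2 := by
      rw [hC, ← Matrix.mulVec_mulVec, Matrix.mulVec_mulVec _ C, Matrix.mul_nonsing_inv _ hCu,
        Matrix.one_mulVec, Matrix.dotProduct_mulVec, Matrix.vecMul_transpose, Matrix.mulVec_mulVec,
        Matrix.mul_nonsing_inv _ hCu, Matrix.one_mulVec]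
      simp [dotProduct, sq]
    have hsq : √((2 * Real.pi)⁻¹ ^ p) = ((√(2 * Real.pi))⁻¹) ^ p := by
      rw [Real.sqrt_eq_iff_mul_self_eq (by positivity) (by positivity), ← mul_pow, ← mul_inv,
        Real.mul_self_sqrt (by positivity)]
    unfold mvn nphi
    rw [e1, e2, e3, Finset.prod_mul_distrib, ← Real.exp_sum, Finset.prod_const, Finset.card_univ,
      Fintype.card_fin, ← mul_assoc]
    congr 1
    · rw [Matrix.det_nonsing_inv, Matrix.det_nonsing_inv, Ring.inverse_eq_inv', hSC, mul_inv, inv_inv,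
        Real.sqrt_mul (by positivity), Real.sqrt_sq_eq_abs, abs_inv, ← inv_pow, hsq]
      · have : |C.det| ≠ 0 := abs_ne_zero.2 hCd
        field_simp
    · congr 1
      rw [← Finset.sum_div, Finset.sum_neg_distrib]
  have q := quad_mom (fun _ : Fin p => nphi) (fun _ => 0) (fun _ => 1) (fun _ => nphi_mom)
    (-(C.mulVec (μ - b))) (C⁻¹ᵀ * N * C⁻¹)
  have e4 : ∀ w, μ + C⁻¹.mulVec w - b = C⁻¹.mulVec (w - -(C.mulVec (μ - b))) := by
    intro w
    rw [sub_neg_eq_add, Matrix.mulVec_add, Matrix.mulVec_mulVec, Matrix.nonsing_inv_mul _ hCu,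
        Matrix.one_mulVec]
    abel
  have e5 : ∀ y, y ⬝ᵥ (C⁻¹ᵀ * N * C⁻¹).mulVec y = C⁻¹.mulVec y ⬝ᵥ N.mulVec (C⁻¹.mulVec y) := by
    intro y
    rw [← Matrix.mulVec_mulVec, ← Matrix.mulVec_mulVec, Matrix.dotProduct_mulVec,
      Matrix.vecMul_transpose]
  have cv := affine_cov C⁻¹ hDu μ (fun x => ((x - b) ⬝ᵥ N.mulVec (x - b)) * mvn μ S⁻¹ x)
  have e6 : (fun w => |C⁻¹.det| * (((μ + C⁻¹.mulVec w - b) ⬝ᵥ N.mulVec (μ + C⁻¹.mulVec w - b)) *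
      mvn μ S⁻¹ (μ + C⁻¹.mulVec w))) = fun w => ((w - -(C.mulVec (μ - b))) ⬝ᵥ
        (C⁻¹ᵀ * N * C⁻¹).mulVec (w - -(C.mulVec (μ - b)))) * ∏ k, nphi (w k) := by
    ext w
    rw [← key, e4, e5]; ring
  rw [cv.1, cv.2, e6]
  refine ⟨q.1, q.2.trans ?_⟩
  congr 1
  · have : ((fun _ : Fin p => (0:ℝ)) - -(C.mulVec (μ - b))) = C.mulVec (μ - b) := by
      ext i; simp
    rw [this, e5, Matrix.mulVec_mulVec, Matrix.nonsing_inv_mul _ hCu, Matrix.one_mulVec]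
  · simp only [mul_one]
    change (C⁻¹ᵀ * N * C⁻¹).trace = _
    rw [hSi, Matrix.mul_assoc, Matrix.trace_mul_comm, Matrix.mul_assoc]

lemma normSq_eq {m : ℕ} (x : Fin m → ℝ) : normSq x = x ⬝ᵥ x := by
  simp [normSq, dotProduct, sq]

lemma normSq_nonneg {m : ℕ} (x : Fin m → ℝ) : 0 ≤ normSq x :=
  Finset.sum_nonneg fun i _ => sq_nonneg _

lemma normSq_pos {m : ℕ} (x : Fin m → ℝ) (hx : x ≠ 0) : 0 < normSq x := by
  refine lt_of_le_of_ne (normSq_nonneg x) fun h => hx ?_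
  rw [normSq_eq] at h
  exact dotProduct_self_eq_zero.1 h.symm

lemma normSq_mulVec {m k : ℕ} (B : Matrix (Fin k) (Fin m) ℝ) (x : Fin m → ℝ) :
    normSq (B.mulVec x) = x ⬝ᵥ (Bᵀ * B).mulVec x := by
  rw [normSq_eq, ← Matrix.mulVec_mulVec, Matrix.dotProduct_mulVec x, Matrix.vecMul_transpose]

section mats
variable {n p : ℕ} (X : Matrix (Fin n) (Fin p) ℝ) (Q : Matrix (Fin p) (Fin p) ℝ)

lemma S_posDef (hQ : Q.PosSemidef) (hSig : IsUnit (Xᵀ * X + Q).det) : (Xᵀ * X + Q).PosDef := by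
  have h1 : (Xᵀ * X).PosSemidef := by
    simpa using Matrix.posSemidef_conjTranspose_mul_self X
  exact (h1.add hQ).posDef_iff_isUnit.2 ((Matrix.isUnit_iff_isUnit_det _).2 hSig)

lemma M_posDef (hQ : Q.PosSemidef) (hSig : IsUnit (Xᵀ * X + Q).det) (hrank : X.rank = n) :
    (X * (Xᵀ * X + Q)⁻¹ * Xᵀ).PosDef := by
  have h := (S_posDef X Q hQ hSig).inv
  have := h.mul_mul_conjTranspose_same (B := X) ?_
  · simpa using this
  · rw [Matrix.vecMul_injective_iff]
    rw [linearIndependent_iff_card_eq_finrank_span]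
    rw [Fintype.card_fin, Set.finrank, ← Matrix.rank_eq_finrank_span_row, hrank]

lemma M_le (hQ : Q.PosSemidef) (hSig : IsUnit (Xᵀ * X + Q).det) (x : Fin n → ℝ) :
    x ⬝ᵥ (X * (Xᵀ * X + Q)⁻¹ * Xᵀ).mulVec x ≤ normSq x := by
  set y := (Xᵀ * X + Q)⁻¹.mulVec (Xᵀ.mulVec x) with hy
  have h1 : x ⬝ᵥ (X * (Xᵀ * X + Q)⁻¹ * Xᵀ).mulVec x = x ⬝ᵥ X.mulVec y := by
    rw [hy, Matrix.mulVec_mulVec, Matrix.mulVec_mulVec, Matrix.mul_assoc]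
  have h2 : (Xᵀ * X + Q).mulVec y = Xᵀ.mulVec x := by
    rw [hy, Matrix.mulVec_mulVec, Matrix.mul_nonsing_inv _ hSig, Matrix.one_mulVec]
  have h3 : y ⬝ᵥ (Xᵀ * X + Q).mulVec y = x ⬝ᵥ X.mulVec y := by
    rw [h2, Matrix.dotProduct_mulVec, Matrix.vecMul_transpose, dotProduct_comm]
  rw [Matrix.add_mulVec, dotProduct_add, ← normSq_mulVec] at h3
  have h4 : 0 ≤ y ⬝ᵥ Q.mulVec y := by simpa using hQ.dotProduct_mulVec_nonneg y
  have h5 := normSq_nonneg (x - X.mulVec y)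
  rw [normSq_eq, sub_dotProduct, dotProduct_sub, dotProduct_sub, dotProduct_comm (X.mulVec y) x,
    ← normSq_eq, ← normSq_eq] at h5
  rw [h1]; linarith

lemma le_lmax (hn : 1 ≤ n) (M : Matrix (Fin n) (Fin n) ℝ) (hM : M.PosSemidef)
    (hM1 : ∀ x, x ⬝ᵥ M.mulVec x ≤ normSq x) :
    0 ≤ lmax M ∧ ∀ x, x ⬝ᵥ M.mulVec x ≤ lmax M * normSq x := by
  have hb : BddAbove {r : ℝ | ∃ x : Fin n → ℝ, x ≠ 0 ∧ r = dotProduct x (M.mulVec x) / normSq x} := by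
    refine ⟨1, ?_⟩
    rintro r ⟨x, hx, rfl⟩
    rw [div_le_one (normSq_pos x hx)]; exact hM1 x
  constructor
  · refine Real.sSup_nonneg ?_
    rintro r ⟨x, hx, rfl⟩
    refine div_nonneg ?_ (normSq_nonneg x)
    simpa using hM.dotProduct_mulVec_nonneg x
  · intro x
    by_cases hx : x = 0
    · subst hx; simp [normSq]
    · rw [← div_le_iff₀ (normSq_pos x hx)]
      exact le_csSup hb ⟨x, hx, rfl⟩

lemma mvn_nonneg (μ : Fin p → ℝ) (Λ : Matrix (Fin p) (Fin p) ℝ) (x : Fin p → ℝ) : 0 ≤ mvn μ Λ x := by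
  unfold mvn; positivity

end mats

/-- the drift inequality for V₂(β) = ‖(XΣ⁻¹Xᵀ)^{-1/2}X(β − B̂)‖².
Here `R` is the positive semidefinite square root of (XΣ⁻¹Xᵀ)⁻¹. -/
theorem drift_inequality_V2
    (n p : ℕ) (hn : 1 ≤ n) (hp : 1 ≤ p)
    (X : Matrix (Fin n) (Fin p) ℝ) (Y : Fin n → Bool)
    (v : Fin p → ℝ) (Q : Matrix (Fin p) (Fin p) ℝ) (hQ : Q.PosSemidef)
    (hSig : IsUnit (Xᵀ * X + Q).det)
    (hrank : X.rank = n)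
    (Bhat : Fin p → ℝ) (hmode : IsPosteriorMode X Y v Q Bhat)
    (R : Matrix (Fin n) (Fin n) ℝ) (hR : R.PosSemidef)
    (hRR : R * R = (X * (Xᵀ * X + Q)⁻¹ * Xᵀ)⁻¹) :
    ∀ β : Fin p → ℝ,
      (∫ β' : Fin p → ℝ, normSq (R.mulVec (X.mulVec (β' - Bhat))) * kAC X Y v Q β β')
        ≤ (lmax (X * (Xᵀ * X + Q)⁻¹ * Xᵀ)) ^ 2 * normSq (R.mulVec (X.mulVec (β - Bhat)))
          + 2 * n := by
  intro β
  have hS := S_posDef X Q hQ hSig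
  have hM := M_posDef X Q hQ hSig hrank
  have hM1 := M_le X Q hQ hSig
  obtain ⟨hl0, hl⟩ := le_lmax hn _ hM.posSemidef hM1
  set M := X * (Xᵀ * X + Q)⁻¹ * Xᵀ with hMdef
  have hMu : IsUnit M.det := hM.det_pos.ne'.isUnit
  have hRt : Rᵀ = R := by simpa using hR.isHermitian.eq
  have hRu : IsUnit R.det := by
    have : IsUnit (R.det * R.det) := by
      rw [← Matrix.det_mul, hRR]; simpa using hMu.ne_zero
    exact isUnit_of_mul_isUnit_left this
  have hRMR : R * M * R = 1 := by
    have h1 : R * (R * M * R) = R * 1 := by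
      rw [← Matrix.mul_assoc, ← Matrix.mul_assoc, hRR, Matrix.nonsing_inv_mul _ hMu]; simp
    have := congrArg (fun Z => R⁻¹ * Z) h1
    simpa [← Matrix.mul_assoc, Matrix.nonsing_inv_mul _ hRu] using this
  set u := X.mulVec (β - Bhat) with hu
  -- the mean of the truncated normals at the mode
  let mh : Fin n → ℝ := fun i => tmean (X i ⬝ᵥ Bhat) (Y i)
  let mb : Fin n → ℝ := fun i => tmean (X i ⬝ᵥ β) (Y i)
  have hfix : (Xᵀ * X + Q).mulVec Bhat = Xᵀ.mulVec mh + Q.mulVec v := by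
    unfold IsPosteriorMode at hmode
    have h1 : (∑ i, (if Y i then nphi (dotProduct (X i) Bhat) / nPhi (dotProduct (X i) Bhat)
          else -(nphi (dotProduct (X i) Bhat) / (1 - nPhi (dotProduct (X i) Bhat)))) • X i)
        = Xᵀ.mulVec (mh - X.mulVec Bhat) := by
      ext j
      have hR : Xᵀ.mulVec (mh - X.mulVec Bhat) j = ∑ i, X i j * (mh - X.mulVec Bhat) i := rfl
      rw [hR, Finset.sum_apply]
      refine Finset.sum_congr rfl fun i _ => ?_
      have : (mh - X.mulVec Bhat) i = (if Y i then gm (X i ⬝ᵥ Bhat) else -gm (-(X i ⬝ᵥ Bhat))) := by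
        simp [mh, tmean, mulVec]
      rw [this, Pi.smul_apply, smul_eq_mul, mul_comm]
      simp only [gm, nPhi_compl, nphi_neg]
    rw [h1, Matrix.mulVec_sub, Matrix.mulVec_sub, Matrix.mulVec_mulVec] at hmode
    rw [Matrix.add_mulVec]
    have := sub_eq_zero.1 hmode
    have h3 : Xᵀ.mulVec mh = (Xᵀ * X).mulVec Bhat + (Q.mulVec Bhat - Q.mulVec v) := by
      rw [← this]; abel
    rw [h3]; abel
  have hB : Bhat = (Xᵀ * X + Q)⁻¹.mulVec (Xᵀ.mulVec mh + Q.mulVec v) := by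
    rw [← hfix, Matrix.mulVec_mulVec, Matrix.nonsing_inv_mul _ hSig, Matrix.one_mulVec]
  let mu : (Fin n → ℝ) → (Fin p → ℝ) := fun z =>
    (Xᵀ * X + Q)⁻¹.mulVec (Xᵀ.mulVec z + Q.mulVec v)
  let N : Matrix (Fin p) (Fin p) ℝ := (R * X)ᵀ * (R * X)
  have hV : ∀ b : Fin p → ℝ, normSq (R.mulVec (X.mulVec (b - Bhat))) =
      (b - Bhat) ⬝ᵥ N.mulVec (b - Bhat) := by
    intro b
    rw [Matrix.mulVec_mulVec, normSq_mulVec]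
  have hmu : ∀ z, normSq (R.mulVec (X.mulVec (mu z - Bhat))) = (z - mh) ⬝ᵥ M.mulVec (z - mh) := by
    intro z
    have : X.mulVec (mu z - Bhat) = M.mulVec (z - mh) := by
      conv_lhs => rw [hB]
      simp only [mu]
      rw [← Matrix.mulVec_sub, add_sub_add_right_eq_sub, ← Matrix.mulVec_sub, Matrix.mulVec_mulVec,
        Matrix.mulVec_mulVec]
    rw [this, Matrix.mulVec_mulVec, normSq_mulVec]
    have hMt : Mᵀ = M := by simpa using hM.isHermitian.eq
    rw [Matrix.transpose_mul, hRt, hMt]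
    have : M * R * (R * M) = M := by
      rw [Matrix.mul_assoc, ← Matrix.mul_assoc R, hRR, Matrix.nonsing_inv_mul _ hMu, Matrix.mul_one]
    rw [this]
  have htr : (N * (Xᵀ * X + Q)⁻¹).trace = n := by
    have : N * (Xᵀ * X + Q)⁻¹ = (Xᵀ * R) * (R * X * (Xᵀ * X + Q)⁻¹) := by
      simp only [N, Matrix.transpose_mul, hRt, Matrix.mul_assoc]
    rw [this, Matrix.trace_mul_comm]
    have : R * X * (Xᵀ * X + Q)⁻¹ * (Xᵀ * R) = R * M * R := by
      simp only [hMdef, Matrix.mul_assoc]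
    rw [this, hRMR]; simp
  let T : (Fin n → ℝ) → ℝ := fun z => ∏ i, tn (X i ⬝ᵥ β) (Y i) (z i)
  have hT0 : ∀ z, 0 ≤ T z := fun z => Finset.prod_nonneg fun i _ => tn_nonneg _ _ _
  have hTm : Measurable T :=
    Finset.measurable_prod _ fun i _ => (tn_meas _ _).comp (measurable_pi_apply i)
  have hmom : ∀ i, HasMom (tn (X i ⬝ᵥ β) (Y i)) (mb i) (tvar (X i ⬝ᵥ β) (Y i)) :=
    fun i => tn_mom _ _
  let F : (Fin p → ℝ) → (Fin n → ℝ) → ℝ := fun b z =>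
    normSq (R.mulVec (X.mulVec (b - Bhat))) * (mvn (mu z) (Xᵀ * X + Q)⁻¹ b * T z)
  have hF0 : ∀ b z, 0 ≤ F b z := fun b z =>
    mul_nonneg (normSq_nonneg _) (mul_nonneg (mvn_nonneg _ _ _) (hT0 z))
  have hG := fun z => gauss_mom (Xᵀ * X + Q) hS (mu z) Bhat N
  have hFe : ∀ z, (fun b => F b z) = fun b =>
      ((b - Bhat) ⬝ᵥ N.mulVec (b - Bhat)) * mvn (mu z) (Xᵀ * X + Q)⁻¹ b * T z := by
    intro z; ext b; simp only [F, hV]; ring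
  have hFi : ∀ z, Integrable (fun b => F b z) := by
    intro z; rw [hFe]; exact (hG z).1.mul_const _
  have hFI : ∀ z, ∫ b, F b z = ((z - mh) ⬝ᵥ M.mulVec (z - mh)) * T z + n * T z := by
    intro z; rw [hFe, integral_mul_const, (hG z).2, ← hV, hmu, htr]; ring
  have hq := quad_mom _ _ _ hmom mh M
  have h1 := prod_one _ _ _ hmom
  have hFm : Measurable (Function.uncurry F) := by
    have hc : Continuous fun q : (Fin p → ℝ) × (Fin n → ℝ) =>
        normSq (R.mulVec (X.mulVec (q.1 - Bhat))) * mvn (mu q.2) (Xᵀ * X + Q)⁻¹ q.1 := by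
      simp only [hV]
      unfold mvn
      have hmc : Continuous mu := by
        simp only [mu]
        fun_prop
      fun_prop
    have : Function.uncurry F = fun q : (Fin p → ℝ) × (Fin n → ℝ) =>
        normSq (R.mulVec (X.mulVec (q.1 - Bhat))) * mvn (mu q.2) (Xᵀ * X + Q)⁻¹ q.1 * T q.2 := by
      ext q; simp only [Function.uncurry, F]; ring
    rw [this]
    exact hc.measurable.mul (hTm.comp measurable_snd)
  have hFint : Integrable (Function.uncurry F) (volume.prod volume) := by
    rw [integrable_prod_iff' hFm.aestronglyMeasurable]
    refine ⟨ae_of_all _ fun z => hFi z, ?_⟩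
    have : (fun z => ∫ b, ‖Function.uncurry F (b, z)‖) =
        fun z => ((z - mh) ⬝ᵥ M.mulVec (z - mh)) * T z + n * T z := by
      ext z
      rw [← hFI]
      refine integral_congr_ae (ae_of_all _ fun b => ?_)
      exact Real.norm_of_nonneg (hF0 b z)
    rw [this]
    exact hq.1.add (h1.1.const_mul _)
  have hLHS : (∫ b, normSq (R.mulVec (X.mulVec (b - Bhat))) * kAC X Y v Q β b) =
      ((mb - mh) ⬝ᵥ M.mulVec (mb - mh)) + ∑ i, M i i * tvar (X i ⬝ᵥ β) (Y i) + n := by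
    have e1 : ∀ b, normSq (R.mulVec (X.mulVec (b - Bhat))) * kAC X Y v Q β b = ∫ z, F b z := by
      intro b
      simp only [F, kAC]
      rw [integral_const_mul]
    simp_rw [e1]
    rw [integral_integral_swap hFint]
    simp_rw [hFI]
    rw [integral_add hq.1 (h1.1.const_mul _), integral_const_mul, hq.2, h1.2, mul_one]
  rw [hLHS]
  have hdiag : ∀ i, M i i * tvar (X i ⬝ᵥ β) (Y i) ≤ 1 := by
    intro i
    have h0 : 0 ≤ M i i := hM.posSemidef.diag_nonneg
    have h2 : M i i ≤ 1 := by
      have := hM1 (Pi.single i 1)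
      rw [normSq_eq] at this
      simpa using this
    have h3 := mul_le_mul_of_nonneg_left (tvar_le (X i ⬝ᵥ β) (Y i)) h0
    linarith
  have hsum : ∑ i, M i i * tvar (X i ⬝ᵥ β) (Y i) ≤ n := by
    have := Finset.sum_le_sum (s := Finset.univ) fun i _ => hdiag i
    simpa using this
  have hd : normSq (mb - mh) ≤ normSq u := by
    refine Finset.sum_le_sum fun i _ => ?_
    rw [sq_le_sq]
    have : u i = X i ⬝ᵥ β - X i ⬝ᵥ Bhat := by
      simp [hu, mulVec, dotProduct_sub]
    rw [this]
    exact tmean_lip _ _ _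
  have hu2 : normSq u ≤ lmax M * normSq (R.mulVec u) := by
    refine le_trans (le_of_eq ?_) (hl (R.mulVec u))
    have h7 : R.mulVec u ⬝ᵥ M.mulVec (R.mulVec u) = u ⬝ᵥ (Rᵀ * (M * R)).mulVec u := by
      rw [← Matrix.mulVec_mulVec u Rᵀ (M * R), Matrix.dotProduct_mulVec u, Matrix.vecMul_transpose,
        Matrix.mulVec_mulVec u M R]
    rw [h7, hRt, ← Matrix.mul_assoc, hRMR, Matrix.one_mulVec, normSq_eq]
  have h5 := hl (mb - mh)
  have h6 := mul_le_mul_of_nonneg_left (hd.trans hu2) hl0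
  nlinarith
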